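/- arXiv:2005.08080 — 4 statements merged into one kernel-verified Lean document; each statement's English description precedes it below -/
import Mathlib

section
/- Let G be a finite simple graph on a nonempty vertex set V with no isolated vertices, and let α : V → V → ℝ be antisymmetric. Let w v u = 1 if u is adjacent to v in G and 0 otherwise. Then for every 1 ≤ k ≤ |V|, the k-th smallest eigenvalue (with multiplicity) of the magnetic standard Laplacian Δ(w, deg_G, α) is less than or equal to the k-th smallest eigenvalue of the magnetic combinatorial Laplacian Δ(w, 1, α): λ_k(w, deg_G, α) ≤ λ_k(w, 1, α). -/
/-- The magnetic weighted Laplacian `Δ(w,m,α)` as a matrix acting on `ℂ^V`: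
`(Δφ)(v) = (1/m v) · Σ_u w v u · (φ(v) − exp(i·α v u)·φ(u))`. -/
noncomputable def magLap {V : Type} [Fintype V] [DecidableEq V]
    (w : V → V → ℝ) (m : V → ℝ) (α : V → V → ℝ) : Matrix V V ℂ :=
  fun v u => (if v = u then (((∑ u', w v u') / m v : ℝ) : ℂ) else 0)
    - ((w v u / m v : ℝ) : ℂ) * Complex.exp (Complex.I * (α v u : ℝ))

/-- The eigenvalues (with multiplicity, nondecreasing) of a matrix with real
spectrum: real parts of the roots of the characteristic polynomial, sorted;
`lamk A k` is the `(k+1)`-st smallest (0-based index). -/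
noncomputable def lamk {V : Type} [Fintype V] [DecidableEq V] (A : Matrix V V ℂ) (k : ℕ) : ℝ :=
  ((A.charpoly.roots.map Complex.re).sort (· ≤ ·)).getD k 0

open Matrix

lemma getD_le_iff (l : List ℝ) (hl : l.Pairwise (· ≤ ·)) (k : ℕ) (hk : k < l.length) (t : ℝ) :
    l.getD k 0 ≤ t ↔ k + 1 ≤ l.countP (fun x => decide (x ≤ t)) := by
  rw [List.getD_eq_getElem _ _ hk]
  have hmono : ∀ i j (hi : i < l.length) (hj : j < l.length), i ≤ j → l[i] ≤ l[j] := by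
    intro i j hi hj hij
    rcases hij.eq_or_lt with h | h
    · subst h; exact le_rfl
    · exact List.pairwise_iff_getElem.1 hl i j hi hj h
  constructor
  · intro h
    have h1 : (l.take (k+1)).countP (fun x => decide (x ≤ t)) = (l.take (k+1)).length := by
      rw [List.countP_eq_length]
      intro a ha
      obtain ⟨i, hi, rfl⟩ := List.mem_iff_getElem.1 ha
      rw [List.length_take] at hi
      rw [List.getElem_take]
      exact decide_eq_true ((hmono i k (by omega) hk (by omega)).trans h)
    have h2 := (List.take_sublist (k+1) l).countP_le (p := fun x => decide (x ≤ t))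
    rw [h1, List.length_take] at h2
    omega
  · intro h
    by_contra hlt
    have h1 : (l.drop k).countP (fun x => decide (x ≤ t)) = 0 := by
      rw [List.countP_eq_zero]
      intro a ha
      obtain ⟨i, hi, rfl⟩ := List.mem_iff_getElem.1 ha
      rw [List.getElem_drop]
      rw [List.length_drop] at hi
      have := hmono k (k+i) hk (by omega) (by omega)
      simp only [decide_eq_true_eq]
      intro h'
      exact hlt (this.trans h')
    have h2 : l.countP (fun x => decide (x ≤ t)) = (l.take k).countP (fun x => decide (x ≤ t))
        + (l.drop k).countP (fun x => decide (x ≤ t)) := by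
      rw [← List.countP_append, List.take_append_drop]
    have h3 := List.countP_le_length (l := l.take k) (p := fun x => decide (x ≤ t))
    rw [List.length_take] at h3
    omega

section
variable {V : Type} [Fintype V] [DecidableEq V]

lemma roots_re {A : Matrix V V ℂ} (hA : A.IsHermitian) :
    A.charpoly.roots.map Complex.re = Finset.univ.val.map hA.eigenvalues := by
  rw [hA.roots_charpoly_eq_eigenvalues, Multiset.map_map]
  refine Multiset.map_congr rfl fun i _ => ?_
  simp

lemma lamk_le_iff {A : Matrix V V ℂ} (hA : A.IsHermitian) (k : ℕ) (hk : k < Fintype.card V)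
    (t : ℝ) : lamk A k ≤ t ↔ k + 1 ≤ Fintype.card {i // hA.eigenvalues i ≤ t} := by
  unfold lamk
  rw [getD_le_iff _ (Multiset.pairwise_sort _ _) k]
  · rw [← Multiset.coe_countP, Multiset.sort_eq, roots_re hA, Multiset.countP_map,
      Fintype.card_subtype]
    simp [Finset.card, Finset.filter]
  · rw [Multiset.length_sort, roots_re hA]
    simpa using hk

lemma lamk_mem {A : Matrix V V ℂ} (k : ℕ) (hA : A.IsHermitian) (hk : k < Fintype.card V) :
    ∃ i, lamk A k = hA.eigenvalues i := by
  unfold lamk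
  have hl : k < ((A.charpoly.roots.map Complex.re).sort (· ≤ ·)).length := by
    rw [Multiset.length_sort, roots_re hA]
    simpa using hk
  rw [List.getD_eq_getElem _ _ hl]
  have := (Multiset.mem_sort _).1 (List.getElem_mem hl)
  generalize ((A.charpoly.roots.map Complex.re).sort (· ≤ ·))[k] = y at this
  rw [roots_re hA] at this
  obtain ⟨i, _, hi⟩ := Multiset.mem_map.1 this
  exact ⟨i, hi.symm⟩

lemma quad {A : Matrix V V ℂ} (hA : A.IsHermitian) (c : V → ℂ) :
    star ((hA.eigenvectorUnitary : Matrix V V ℂ) *ᵥ c) ⬝ᵥ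
      (A *ᵥ ((hA.eigenvectorUnitary : Matrix V V ℂ) *ᵥ c))
      = ∑ i, ((hA.eigenvalues i * ‖c i‖ ^ 2 : ℝ) : ℂ) := by
  have h := hA.conjStarAlgAut_star_eigenvectorUnitary
  rw [Unitary.conjStarAlgAut_star_apply] at h
  rw [star_mulVec, ← dotProduct_mulVec, mulVec_mulVec, mulVec_mulVec,
    ← star_eq_conjTranspose, h]
  simp only [dotProduct, mulVec_diagonal, Pi.star_apply]
  refine Finset.sum_congr rfl fun i _ => ?_
  have := Complex.conj_mul' (c i)
  simp only [Function.comp, RCLike.star_def]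
  push_cast
  rw [← this]
  simp
  ring

lemma quad1 {A : Matrix V V ℂ} (hA : A.IsHermitian) (c : V → ℂ) :
    star ((hA.eigenvectorUnitary : Matrix V V ℂ) *ᵥ c) ⬝ᵥ
      ((hA.eigenvectorUnitary : Matrix V V ℂ) *ᵥ c)
      = ∑ i, ((‖c i‖ ^ 2 : ℝ) : ℂ) := by
  rw [star_mulVec, ← dotProduct_mulVec, mulVec_mulVec, 
    ← star_eq_conjTranspose, Unitary.coe_star_mul_self, one_mulVec]
  simp only [dotProduct, Pi.star_apply]
  refine Finset.sum_congr rfl fun i _ => ?_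
  have := Complex.conj_mul' (c i)
  push_cast
  rw [← this]
  simp

lemma quadt {A : Matrix V V ℂ} (hA : A.IsHermitian) (t : ℝ) (c : V → ℂ) :
    (star ((hA.eigenvectorUnitary : Matrix V V ℂ) *ᵥ c) ⬝ᵥ
      (A *ᵥ ((hA.eigenvectorUnitary : Matrix V V ℂ) *ᵥ c))).re
      - t * (star ((hA.eigenvectorUnitary : Matrix V V ℂ) *ᵥ c) ⬝ᵥ
      ((hA.eigenvectorUnitary : Matrix V V ℂ) *ᵥ c)).re
      = ∑ i, (hA.eigenvalues i - t) * ‖c i‖ ^ 2 := by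
  rw [quad, quad1, ← Complex.ofReal_sum, ← Complex.ofReal_sum, Complex.ofReal_re,
    Complex.ofReal_re, Finset.mul_sum, ← Finset.sum_sub_distrib]
  exact Finset.sum_congr rfl fun i _ => by ring

lemma unit_inj {A : Matrix V V ℂ} (hA : A.IsHermitian) (c : V → ℂ)
    (h : (hA.eigenvectorUnitary : Matrix V V ℂ) *ᵥ c = 0) : c = 0 := by
  have := congrArg (fun x => star (hA.eigenvectorUnitary : Matrix V V ℂ) *ᵥ x) h
  simpa [mulVec_mulVec] using this

lemma count_le {A B : Matrix V V ℂ} (hA : A.IsHermitian) (hB : B.IsHermitian) (t : ℝ)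
    (T : Matrix V V ℂ) (hT : ∀ x, T *ᵥ x = 0 → x = 0)
    (h : ∀ x, (star x ⬝ᵥ (A *ᵥ x)).re - t * (star x ⬝ᵥ x).re ≤ 0 →
      (star (T *ᵥ x) ⬝ᵥ (B *ᵥ (T *ᵥ x))).re - t * (star (T *ᵥ x) ⬝ᵥ (T *ᵥ x)).re ≤ 0) :
    Fintype.card {i // hA.eigenvalues i ≤ t} ≤ Fintype.card {i // hB.eigenvalues i ≤ t} := by
  let UA := (hA.eigenvectorUnitary : Matrix V V ℂ)
  let UB := (hB.eigenvectorUnitary : Matrix V V ℂ)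
  let eA : ({i // hA.eigenvalues i ≤ t} → ℂ) →ₗ[ℂ] (V → ℂ) :=
    Function.ExtendByZero.linearMap ℂ (Subtype.val)
  let eB : ({i // ¬ hB.eigenvalues i ≤ t} → ℂ) →ₗ[ℂ] (V → ℂ) :=
    Function.ExtendByZero.linearMap ℂ (Subtype.val)
  have eA1 : ∀ c i, eA c i.1 = c i := fun c i => Subtype.val_injective.extend_apply _ _ _
  have eB1 : ∀ c i, eB c i.1 = c i := fun c i => Subtype.val_injective.extend_apply _ _ _
  have eA0 : ∀ c i, ¬ hA.eigenvalues i ≤ t → eA c i = 0 := fun c i hi =>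
    Function.extend_apply' _ _ _ (by rintro ⟨a, rfl⟩; exact hi a.2)
  have eB0 : ∀ c i, hB.eigenvalues i ≤ t → eB c i = 0 := fun c i hi =>
    Function.extend_apply' _ _ _ (by rintro ⟨a, rfl⟩; exact a.2 hi)
  let F : (({i // hA.eigenvalues i ≤ t} → ℂ) × ({i // ¬ hB.eigenvalues i ≤ t} → ℂ)) →ₗ[ℂ] (V → ℂ) :=
    ((T.mulVecLin ∘ₗ UA.mulVecLin ∘ₗ eA).coprod (-(UB.mulVecLin ∘ₗ eB)))
  have hF : Function.Injective F := by
    rw [← LinearMap.ker_eq_bot, LinearMap.ker_eq_bot']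
    rintro ⟨c, d⟩ hcd
    have e : T *ᵥ (UA *ᵥ eA c) = UB *ᵥ eB d := by
      have : T *ᵥ (UA *ᵥ eA c) + -(UB *ᵥ eB d) = 0 := hcd
      rwa [← sub_eq_add_neg, sub_eq_zero] at this
    have h1 := h (UA *ᵥ eA c) (by
      rw [quadt]
      refine Finset.sum_nonpos fun i _ => ?_
      by_cases hi : hA.eigenvalues i ≤ t
      · exact mul_nonpos_of_nonpos_of_nonneg (by linarith) (by positivity)
      · simp [eA0 c i hi])
    rw [e, quadt] at h1
    have hnn : ∀ i ∈ Finset.univ, 0 ≤ (hB.eigenvalues i - t) * ‖eB d i‖ ^ 2 := by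
      intro i _
      by_cases hi : hB.eigenvalues i ≤ t
      · simp [eB0 d i hi]
      · exact mul_nonneg (by linarith [not_le.1 hi]) (by positivity)
    have h2 := (Finset.sum_eq_zero_iff_of_nonneg hnn).1 (le_antisymm h1 (Finset.sum_nonneg hnn))
    have hd : d = 0 := by
      funext i
      have := h2 i.1 (Finset.mem_univ _)
      rw [eB1] at this
      have hp : hB.eigenvalues i.1 - t ≠ 0 := by linarith [not_le.1 i.2, sub_pos.2 (not_le.1 i.2)] |> fun (h : 0 < hB.eigenvalues i.1 - t) => h.ne'
      simpa [hp] using this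
    subst hd
    rw [map_zero, mulVec_zero] at e
    have hc := unit_inj hA _ (hT _ e)
    have hc' : c = 0 := by
      funext i
      rw [← eA1 c i, hc]; rfl
    rw [hc']; rfl
  have hr := LinearMap.finrank_le_finrank_of_injective hF
  rw [Module.finrank_prod, Module.finrank_fintype_fun_eq_card, Module.finrank_fintype_fun_eq_card,
    Module.finrank_fintype_fun_eq_card, Fintype.card_subtype_compl] at hr
  have := Fintype.card_subtype_le (fun i => hB.eigenvalues i ≤ t)
  omega

lemma magLap_herm (w : V → V → ℝ) (hw : ∀ v u, w v u = w u v) (α : V → V → ℝ)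
    (hα : ∀ v u, α v u = - α u v) : (magLap w (fun _ => 1) α).IsHermitian := by
  ext v u
  simp only [conjTranspose_apply, magLap, star_sub, star_mul', RCLike.star_def, ← Complex.exp_conj,
    map_mul, Complex.conj_I, Complex.conj_ofReal]
  rw [hw u v, hα u v]
  congr 1
  · by_cases h : v = u
    · subst h; simp
    · simp [h, Ne.symm h]
  · push_cast; ring_nf

lemma magLap_nonneg (w : V → V → ℝ) (hw0 : ∀ v, w v v = 0) (hwn : ∀ v u, 0 ≤ w v u)
    (α : V → V → ℝ) (hA : (magLap w (fun _ => 1) α).IsHermitian) (i : V) :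
    0 ≤ hA.eigenvalues i := by
  have h1 : Module.End.HasEigenvalue (Matrix.toLin' (magLap w (fun _ => 1) α))
      (hA.eigenvalues i : ℂ) := by
    rw [Module.End.hasEigenvalue_iff_isRoot_charpoly, Matrix.charpoly_toLin', hA.charpoly_eq,
      Polynomial.IsRoot, Polynomial.eval_prod]
    exact Finset.prod_eq_zero (Finset.mem_univ i) (by simp)
  obtain ⟨k, hk⟩ := eigenvalue_mem_ball h1
  rw [Metric.mem_closedBall, dist_eq_norm] at hk
  have h2 : magLap w (fun _ => 1) α k k = ((∑ u, w k u : ℝ) : ℂ) := by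
    simp [magLap, hw0]
  have h3 : ∑ j ∈ Finset.univ.erase k, ‖magLap w (fun _ => 1) α k j‖ = ∑ u, w k u := by
    rw [← Finset.sum_erase Finset.univ (hw0 k)]
    refine Finset.sum_congr rfl fun j hj => ?_
    have : k ≠ j := (Finset.ne_of_mem_erase hj).symm
    simp only [magLap, if_neg this, zero_sub, norm_neg, norm_mul]
    rw [mul_comm Complex.I, Complex.norm_exp_ofReal_mul_I]
    simp [abs_of_nonneg (hwn k j)]
  rw [h2, h3, ← Complex.ofReal_sub, Complex.norm_real, Real.norm_eq_abs] at hk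
  linarith [(abs_le.1 hk).1]

lemma main_aux (w : V → V → ℝ) (hw0 : ∀ v, w v v = 0) (hwn : ∀ v u, 0 ≤ w v u)
    (hw : ∀ v u, w v u = w u v) (m : V → ℝ) (hm : ∀ v, 1 ≤ m v)
    (α : V → V → ℝ) (hα : ∀ v u, α v u = - α u v) (k : ℕ) (hk : k < Fintype.card V) :
    lamk (magLap w m α) k ≤ lamk (magLap w (fun _ => 1) α) k := by
  have hA := magLap_herm w hw α hα
  set L := magLap w (fun _ => 1) α with hL
  let E : Matrix V V ℂ := diagonal fun v => ((√(m v) : ℝ) : ℂ)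
  let E' : Matrix V V ℂ := diagonal fun v => (((√(m v))⁻¹ : ℝ) : ℂ)
  have hs : ∀ v, √(m v) ≠ 0 := fun v => (Real.sqrt_pos.2 (by linarith [hm v])).ne'
  have hE : E' * E = 1 := by
    simp only [E, E', diagonal_mul_diagonal, ← Complex.ofReal_mul, inv_mul_cancel₀ (hs _)]
    simp
  have hE'H : E'ᴴ = E' := by
    simp only [E', diagonal_conjTranspose]
    congr 1; funext v; simp
  have hEH : Eᴴ = E := by
    simp only [E, diagonal_conjTranspose]
    congr 1; funext v; simp
  have hB : (E' * L * E').IsHermitian := by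
    rw [IsHermitian, conjTranspose_mul, conjTranspose_mul, hE'H, hA.eq, mul_assoc]
  have hM : magLap w m α = E' * (E' * L) := by
    ext v u
    simp only [E', diagonal_mul]
    have h1 : (((√(m v))⁻¹ : ℝ) : ℂ) * (((√(m v))⁻¹ : ℝ) : ℂ) = ((m v)⁻¹ : ℝ) := by
      rw [← Complex.ofReal_mul, ← mul_inv, Real.mul_self_sqrt (by linarith [hm v])]
    rw [← mul_assoc, h1]
    simp only [hL, magLap]
    split_ifs <;> push_cast <;> ring
  have hlam : lamk (magLap w m α) k = lamk (E' * L * E') k := by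
    unfold lamk
    rw [hM, charpoly_mul_comm]
  rw [hlam, lamk_le_iff hB k hk]
  refine le_trans ((lamk_le_iff hA k hk _).1 le_rfl) ?_
  have ht : 0 ≤ lamk L k := by
    obtain ⟨i, hi⟩ := lamk_mem k hA hk
    rw [hi]
    exact magLap_nonneg w hw0 hwn α hA i
  generalize lamk L k = t at ht
  have hE2 : E * E' = 1 := mul_eq_one_comm.1 hE
  refine count_le hA hB t E ?_ ?_
  · intro x hx
    have := congrArg (fun y => E' *ᵥ y) hx
    simpa [mulVec_mulVec, hE] using this
  · intro x hx
    have e1 : star (E *ᵥ x) ⬝ᵥ ((E' * L * E') *ᵥ (E *ᵥ x)) = star x ⬝ᵥ (L *ᵥ x) := by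
      rw [star_mulVec, ← dotProduct_mulVec, mulVec_mulVec, mulVec_mulVec, hEH]
      congr 2
      calc E * (E' * L * E') * E = (E * E') * L * (E' * E) := by simp only [mul_assoc]
        _ = L := by rw [hE, hE2, one_mul, mul_one]
    have e2 : (star x ⬝ᵥ x).re ≤ (star (E *ᵥ x) ⬝ᵥ (E *ᵥ x)).re := by
      simp only [dotProduct, E, mulVec_diagonal, Complex.re_sum, Pi.star_apply, RCLike.star_def,
        Complex.conj_mul', norm_mul, Complex.norm_real]
      refine Finset.sum_le_sum fun i _ => ?_
      rw [← Complex.ofReal_pow, ← Complex.ofReal_pow, Complex.ofReal_re,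
        Complex.ofReal_re, mul_pow, Real.norm_eq_abs, sq_abs, Real.sq_sqrt (by linarith [hm i])]
      nlinarith [hm i, sq_nonneg ‖x i‖]
    rw [e1]
    nlinarith [mul_le_mul_of_nonneg_left e2 ht]

end

/-- each eigenvalue of the magnetic standard Laplacian (vertex
weight `deg_G`) is at most the corresponding eigenvalue of the magnetic
combinatorial Laplacian (vertex weight `1`), for the same graph and potential. -/
theorem stmt7 {V : Type} [Fintype V] [DecidableEq V] [Nonempty V]
    (G : SimpleGraph V) [DecidableRel G.Adj]
    (hdeg : ∀ v : V, 0 < G.degree v)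
    (α : V → V → ℝ) (hα : ∀ v u, α v u = - α u v) :
    ∀ k : ℕ, 1 ≤ k → k ≤ Fintype.card V →
      lamk (magLap (fun v u => if G.Adj v u then 1 else 0)
          (fun v => (G.degree v : ℝ)) α) (k - 1)
        ≤ lamk (magLap (fun v u => if G.Adj v u then 1 else 0)
          (fun _ => 1) α) (k - 1) := by
  intro k hk1 hk2
  refine main_aux _ ?_ ?_ ?_ _ ?_ α hα _ (by omega)
  · intro v; simp
  · intro v u; split_ifs <;> norm_num
  · intro v u; simp only [G.adj_comm]
  · intro v; exact_mod_cast hdeg v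
end

section
/- Let V be a nonempty finite type, α : V → V → ℝ antisymmetric, and let (w, m) and (w', m') be weights on V (edge weights symmetric, nonnegative, vanishing on the diagonal; vertex weights positive) with w' v u ≤ w v u for all v, u ∈ V and m v ≤ m' v for all v ∈ V. Then λ_k(w', m', α) ≤ λ_k(w, m, α) for all 1 ≤ k ≤ |V|. -/
open Matrix in
theorem aux_diag {V : Type} [Fintype V] [DecidableEq V] {H : Matrix V V ℂ} (hH : H.IsHermitian) :
    ∃ U : Matrix V V ℂ,
      (∀ x : V → ℂ, (star x ⬝ᵥ (H *ᵥ x)).re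
        = ∑ i, hH.eigenvalues i * Complex.normSq ((U *ᵥ x) i)) ∧
      (∀ x : V → ℂ, ∑ i, Complex.normSq (x i) = ∑ i, Complex.normSq ((U *ᵥ x) i)) := by
  have hn : ∀ x : V → ℂ, ∑ i, Complex.normSq (x i) = (star x ⬝ᵥ x).re := by
    intro x
    simp [dotProduct, Complex.normSq_apply]
  refine ⟨star (hH.eigenvectorUnitary : Matrix V V ℂ), fun x => ?_, fun x => ?_⟩
  · conv_lhs => rw [hH.spectral_theorem, Unitary.conjStarAlgAut_apply]
    rw [← mulVec_mulVec, ← mulVec_mulVec, dotProduct_mulVec,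
      show star x ᵥ* (hH.eigenvectorUnitary : Matrix V V ℂ)
        = star (star (hH.eigenvectorUnitary : Matrix V V ℂ) *ᵥ x) by
        rw [star_mulVec]; simp [star_eq_conjTranspose]]
    simp only [dotProduct, mulVec_diagonal, Complex.re_sum]
    refine Finset.sum_congr rfl fun i _ => ?_
    simp [Complex.normSq_apply]
    ring
  · rw [hn, hn, star_mulVec, ← dotProduct_mulVec, mulVec_mulVec, ← star_eq_conjTranspose,
      star_star, Unitary.mul_star_self_of_mem hH.eigenvectorUnitary.2, one_mulVec]

open Matrix in
theorem aux_count {V : Type} [Fintype V] [DecidableEq V] {H H' : Matrix V V ℂ}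
    (hH : H.IsHermitian) (hH' : H'.IsHermitian) (T : Matrix V V ℂ)
    (h0 : ∀ x : V → ℂ, 0 ≤ (star x ⬝ᵥ (H *ᵥ x)).re)
    (hle : ∀ x : V → ℂ, (star (T *ᵥ x) ⬝ᵥ (H' *ᵥ (T *ᵥ x))).re ≤ (star x ⬝ᵥ (H *ᵥ x)).re)
    (hT : ∀ x : V → ℂ, ∑ i, Complex.normSq (x i) ≤ ∑ i, Complex.normSq ((T *ᵥ x) i)) (t : ℝ) :
    Fintype.card {i // hH.eigenvalues i ≤ t} ≤ Fintype.card {i // hH'.eigenvalues i ≤ t} := by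
  obtain ⟨U, hU, hUn⟩ := aux_diag hH
  obtain ⟨U', hU', hUn'⟩ := aux_diag hH'
  by_contra! hlt
  have hc := Fintype.card_subtype_compl (fun i => hH.eigenvalues i ≤ t)
  have hc2 := Fintype.card_subtype_le (fun i => hH.eigenvalues i ≤ t)
  let f : (V → ℂ) →ₗ[ℂ] (({i // ¬ hH.eigenvalues i ≤ t} → ℂ) × ({i // hH'.eigenvalues i ≤ t} → ℂ)) :=
    ((LinearMap.funLeft ℂ ℂ Subtype.val).comp U.mulVecLin).prod
      ((LinearMap.funLeft ℂ ℂ Subtype.val).comp (U' * T).mulVecLin)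
  have hk : LinearMap.ker f ≠ ⊥ := by
    apply LinearMap.ker_ne_bot_of_finrank_lt
    rw [Module.finrank_prod, Module.finrank_fintype_fun_eq_card, Module.finrank_fintype_fun_eq_card,
      Module.finrank_fintype_fun_eq_card]
    omega
  obtain ⟨x, hx, hx0⟩ := Submodule.exists_mem_ne_zero_of_ne_bot hk
  have hfx : f x = 0 := hx
  have h1 : ∀ i, ¬ hH.eigenvalues i ≤ t → (U *ᵥ x) i = 0 := fun i hi =>
    congrFun (congrArg Prod.fst hfx) ⟨i, hi⟩
  have h2 : ∀ i, hH'.eigenvalues i ≤ t → (U' *ᵥ (T *ᵥ x)) i = 0 := fun i hi => by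
    rw [mulVec_mulVec]
    exact congrFun (congrArg Prod.snd hfx) ⟨i, hi⟩
  have hxpos : 0 < ∑ i, Complex.normSq (x i) := by
    obtain ⟨i, hi⟩ := Function.ne_iff.mp hx0
    exact Finset.sum_pos' (fun i _ => Complex.normSq_nonneg _)
      ⟨i, Finset.mem_univ _, Complex.normSq_pos.mpr hi⟩
  have hA : (star x ⬝ᵥ (H *ᵥ x)).re ≤ t * ∑ i, Complex.normSq (x i) := by
    rw [hU, hUn, Finset.mul_sum]
    refine Finset.sum_le_sum fun i _ => ?_
    by_cases hi : hH.eigenvalues i ≤ t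
    · exact mul_le_mul_of_nonneg_right hi (Complex.normSq_nonneg _)
    · simp [h1 i hi]
  have hB : t * ∑ i, Complex.normSq ((T *ᵥ x) i)
      < (star (T *ᵥ x) ⬝ᵥ (H' *ᵥ (T *ᵥ x))).re := by
    have hpos := lt_of_lt_of_le hxpos (hT x)
    rw [hUn'] at hpos
    rw [hU', hUn', Finset.mul_sum]
    obtain ⟨i, -, hi⟩ := Finset.exists_ne_zero_of_sum_ne_zero hpos.ne'
    refine Finset.sum_lt_sum (fun j _ => ?_) ⟨i, Finset.mem_univ _, ?_⟩
    · by_cases hj : hH'.eigenvalues j ≤ t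
      · simp [h2 j hj]
      · exact mul_le_mul_of_nonneg_right (not_le.mp hj).le (Complex.normSq_nonneg _)
    · have hi' : ¬ hH'.eigenvalues i ≤ t := fun h => hi (by simp [h2 i h])
      exact mul_lt_mul_of_pos_right (not_le.mp hi')
        (lt_of_le_of_ne (Complex.normSq_nonneg _) (Ne.symm hi))
  have ht : 0 ≤ t := by
    by_contra! h
    nlinarith [h0 x]
  nlinarith [hle x, mul_le_mul_of_nonneg_left (hT x) ht]

theorem aux_list (l l' : List ℝ) (hl : l.Pairwise (· ≤ ·)) (hl' : l'.Pairwise (· ≤ ·))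
    (hlen : l.length = l'.length)
    (hc : ∀ t : ℝ, l.countP (fun a => decide (a ≤ t)) ≤ l'.countP (fun a => decide (a ≤ t)))
    (k : ℕ) : l'.getD k 0 ≤ l.getD k 0 := by
  by_cases hk : k < l.length
  · have hk' : k < l'.length := hlen ▸ hk
    rw [List.getD_eq_getElem _ _ hk, List.getD_eq_getElem _ _ hk']
    by_contra! hlt
    have h1 : k + 1 ≤ l.countP (fun a => decide (a ≤ l[k])) := by
      have : (l.take (k+1)).countP (fun a => decide (a ≤ l[k])) = (l.take (k+1)).length := by
        rw [List.countP_eq_length]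
        intro a ha
        obtain ⟨i, hi, rfl⟩ := List.mem_take_iff_getElem.mp ha
        have : i ≤ k := by omega
        rcases this.eq_or_lt with h | h
        · subst h; simp
        · simpa using List.pairwise_iff_getElem.mp hl i k (by omega) hk h
      have h3 := (List.take_sublist (k+1) l).countP_le (p := fun a => decide (a ≤ l[k]))
      rw [this, List.length_take] at h3
      omega
    have h2 : l'.countP (fun a => decide (a ≤ l[k])) ≤ k := by
      have : (l'.drop k).countP (fun a => decide (a ≤ l[k])) = 0 := by
        rw [List.countP_eq_zero]
        intro a ha
        obtain ⟨i, hi, rfl⟩ := List.mem_drop_iff_getElem.mp ha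
        rcases Nat.eq_zero_or_pos i with h | h
        · subst h; simpa using hlt
        · have := List.pairwise_iff_getElem.mp hl' k (k + i) hk' (by omega) (by omega)
          simpa using lt_of_lt_of_le hlt this
      rw [← List.take_append_drop k l', List.countP_append, this]
      exact (List.countP_le_length).trans (by simp)
    have := hc l[k]
    omega
  · rw [List.getD_eq_default _ _ (by omega), List.getD_eq_default _ _ (by omega)]

theorem aux_lamk {V : Type} [Fintype V] [DecidableEq V] {A A' H H' : Matrix V V ℂ}
    (hH : H.IsHermitian) (hH' : H'.IsHermitian) (hA : A.charpoly = H.charpoly)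
    (hA' : A'.charpoly = H'.charpoly)
    (hc : ∀ t, Fintype.card {i // hH.eigenvalues i ≤ t}
      ≤ Fintype.card {i // hH'.eigenvalues i ≤ t}) (k : ℕ) : lamk A' k ≤ lamk A k := by
  have key : ∀ {B : Matrix V V ℂ} (hB : B.IsHermitian),
      B.charpoly.roots.map Complex.re = Multiset.map hB.eigenvalues Finset.univ.val := by
    intro B hB
    rw [hB.roots_charpoly_eq_eigenvalues, Multiset.map_map]
    rfl
  have cnt : ∀ {B : Matrix V V ℂ} (hB : B.IsHermitian) (t : ℝ),
      ((Multiset.map hB.eigenvalues Finset.univ.val).sort (· ≤ ·)).countP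
        (fun a => decide (a ≤ t)) = Fintype.card {i // hB.eigenvalues i ≤ t} := by
    intro B hB t
    rw [← Multiset.coe_countP, Multiset.sort_eq, Multiset.countP_map, Fintype.card_subtype]
    rfl
  unfold lamk
  rw [hA, hA', key hH, key hH']
  apply aux_list
  · exact Multiset.pairwise_sort _ _
  · exact Multiset.pairwise_sort _ _
  · simp
  · intro t
    rw [cnt, cnt]
    exact hc t

/-- The unnormalized magnetic Laplacian is Hermitian. -/
theorem aux_herm {V : Type} [Fintype V] [DecidableEq V] (w α : V → V → ℝ)
    (hw : ∀ v u, w v u = w u v) (hα : ∀ v u, α v u = - α u v) :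
    (magLap w (fun _ => 1) α).IsHermitian := by
  ext v u
  simp only [Matrix.conjTranspose_apply, magLap, star_sub, star_mul', Complex.star_def,
    ← Complex.exp_conj, map_mul, Complex.conj_I, Complex.conj_ofReal, div_one]
  rw [hw u v, hα u v]
  congr 1
  · by_cases h : v = u
    · subst h; simp
    · simp [h, Ne.symm h]
  · simp

open Matrix in
theorem aux_form {V : Type} [Fintype V] [DecidableEq V] (w α : V → V → ℝ) (x : V → ℂ) :
    (star x ⬝ᵥ (magLap w (fun _ => 1) α *ᵥ x)).re =
      ∑ v, ∑ u, w v u * (Complex.normSq (x v)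
        - (star (x v) * (Complex.exp (Complex.I * (α v u : ℝ)) * x u)).re) := by
  simp only [dotProduct, Complex.re_sum]
  refine Finset.sum_congr rfl fun v _ => ?_
  have : (magLap w (fun _ => 1) α *ᵥ x) v = ∑ u, (w v u : ℂ) *
      (x v - Complex.exp (Complex.I * (α v u : ℝ)) * x u) := by
    simp only [mulVec, dotProduct, magLap, sub_mul, ite_mul, zero_mul, Finset.sum_sub_distrib,
      Finset.sum_ite_eq, Finset.mem_univ, if_true, div_one, mul_sub, Complex.ofReal_sum,
      Finset.sum_mul, mul_assoc]
  rw [this, Finset.mul_sum, Complex.re_sum]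
  refine Finset.sum_congr rfl fun u _ => ?_
  rw [mul_left_comm, Complex.re_ofReal_mul, mul_sub, Complex.sub_re]
  simp [Complex.normSq_apply]

open Matrix in
theorem aux_nonneg {V : Type} [Fintype V] [DecidableEq V] (w α : V → V → ℝ)
    (hw : ∀ v u, w v u = w u v) (hw0 : ∀ v u, 0 ≤ w v u) (hα : ∀ v u, α v u = - α u v)
    (x : V → ℂ) : 0 ≤ (star x ⬝ᵥ (magLap w (fun _ => 1) α *ᵥ x)).re := by
  rw [aux_form]
  set F : V → V → ℝ := fun v u => w v u * (Complex.normSq (x v)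
        - (star (x v) * (Complex.exp (Complex.I * (α v u : ℝ)) * x u)).re) with hF
  have hs : ∑ v, ∑ u, F v u = ∑ v, ∑ u, F u v := Finset.sum_comm
  have h2 : 0 ≤ ∑ v, ∑ u, (F v u + F u v) := by
    refine Finset.sum_nonneg fun v _ => Finset.sum_nonneg fun u _ => ?_
    have hre : (star (x u) * (Complex.exp (Complex.I * (α u v : ℝ)) * x v)).re
        = (star (x v) * (Complex.exp (Complex.I * (α v u : ℝ)) * x u)).re := by
      rw [← Complex.conj_re]
      congr 1
      simp only [map_mul, Complex.star_def, Complex.conj_conj, ← Complex.exp_conj, Complex.conj_I,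
        Complex.conj_ofReal]
      rw [hα u v]
      push_cast
      rw [show -Complex.I * -(α v u : ℂ) = Complex.I * (α v u : ℂ) by ring]
      ring
    have hns : Complex.normSq (Complex.exp (Complex.I * (α v u : ℝ)) * x u)
        = Complex.normSq (x u) := by
      rw [Complex.normSq_mul, Complex.normSq_eq_norm_sq (Complex.exp _), mul_comm Complex.I,
        Complex.norm_exp_ofReal_mul_I]
      simp
    have hp := Complex.normSq_nonneg (x v - Complex.exp (Complex.I * (α v u : ℝ)) * x u)
    rw [Complex.normSq_sub, hns, ← Complex.conj_re (x v * _)] at hp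
    simp only [map_mul, Complex.conj_conj] at hp
    simp only [hF]
    rw [hre, hw u v, ← mul_add]
    refine mul_nonneg (hw0 v u) ?_
    simp only [Complex.star_def]
    linarith
  simp only [Finset.sum_add_distrib] at h2
  linarith

open Matrix in
theorem aux_conj {V : Type} [Fintype V] [DecidableEq V] (L : Matrix V V ℂ) (d : V → ℝ)
    (x : V → ℂ) :
    star x ⬝ᵥ ((diagonal (fun v => (d v : ℂ)) * L * diagonal (fun v => (d v : ℂ))) *ᵥ x)
      = star (diagonal (fun v => (d v : ℂ)) *ᵥ x) ⬝ᵥ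
        (L *ᵥ (diagonal (fun v => (d v : ℂ)) *ᵥ x)) := by
  rw [← mulVec_mulVec, ← mulVec_mulVec, dotProduct_mulVec]
  congr 1
  ext v
  simp [vecMul_diagonal, mulVec_diagonal, mul_comm]

open Matrix in
theorem aux_charpoly {V : Type} [Fintype V] [DecidableEq V] (w α : V → V → ℝ) (m : V → ℝ)
    (hm : ∀ v, 0 < m v) :
    (magLap w m α).charpoly = (diagonal (fun v => (((Real.sqrt (m v))⁻¹ : ℝ) : ℂ)) *
      magLap w (fun _ => 1) α * diagonal (fun v => (((Real.sqrt (m v))⁻¹ : ℝ) : ℂ))).charpoly := by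
  rw [charpoly_mul_comm]
  congr 1
  ext v u
  rw [diagonal_mul, diagonal_mul, ← mul_assoc, ← Complex.ofReal_mul, ← mul_inv,
    Real.mul_self_sqrt (hm v).le]
  simp only [magLap, div_one, mul_sub, mul_ite, mul_zero]
  congr 1
  · push_cast; rw [div_eq_inv_mul]
  · push_cast; rw [div_eq_inv_mul, mul_assoc]

/-- decreasing all edge weights and increasing all vertex
weights decreases every eigenvalue of the magnetic weighted Laplacian. -/
theorem stmt8 {V : Type} [Fintype V] [DecidableEq V] [Nonempty V]
    (w w' : V → V → ℝ) (m m' : V → ℝ) (α : V → V → ℝ)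
    (hw_symm : ∀ v u, w v u = w u v) (hw_nonneg : ∀ v u, 0 ≤ w v u)
    (hw_diag : ∀ v, w v v = 0)
    (hw'_symm : ∀ v u, w' v u = w' u v) (hw'_nonneg : ∀ v u, 0 ≤ w' v u)
    (hw'_diag : ∀ v, w' v v = 0)
    (hm : ∀ v, 0 < m v) (hm' : ∀ v, 0 < m' v)
    (hα : ∀ v u, α v u = - α u v)
    (hww' : ∀ v u, w' v u ≤ w v u)
    (hmm' : ∀ v, m v ≤ m' v) :
    ∀ k : ℕ, 1 ≤ k → k ≤ Fintype.card V →
      lamk (magLap w' m' α) (k - 1) ≤ lamk (magLap w m α) (k - 1) := by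
  intro k _ _
  open Matrix in
  have hherm : ∀ (w : V → V → ℝ) (d : V → ℝ), (∀ v u, w v u = w u v) →
      (diagonal (fun v => (d v : ℂ)) * magLap w (fun _ => 1) α *
        diagonal (fun v => (d v : ℂ))).IsHermitian := by
    intro w d hw
    have hD : (diagonal (fun v => (d v : ℂ)))ᴴ = diagonal (fun v => (d v : ℂ)) := by
      rw [diagonal_conjTranspose]; congr 1; ext v; simp
    have := isHermitian_mul_mul_conjTranspose (diagonal (fun v => (d v : ℂ)))
      (aux_herm w α hw hα)
    rwa [hD] at this
  refine aux_lamk (hherm w (fun v => (Real.sqrt (m v))⁻¹) hw_symm)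
    (hherm w' (fun v => (Real.sqrt (m' v))⁻¹) hw'_symm)
    (aux_charpoly w α m hm) (aux_charpoly w' α m' hm') ?_ _
  refine aux_count _ _ (Matrix.diagonal (fun v => ((Real.sqrt (m' v) / Real.sqrt (m v) : ℝ) : ℂ)))
    ?_ ?_ ?_
  · intro x
    rw [aux_conj]
    exact aux_nonneg w α hw_symm hw_nonneg hα _
  · intro x
    rw [aux_conj, aux_conj, Matrix.mulVec_mulVec, Matrix.diagonal_mul_diagonal]
    have : (fun v => (((Real.sqrt (m' v))⁻¹ : ℝ) : ℂ) *
        ((Real.sqrt (m' v) / Real.sqrt (m v) : ℝ) : ℂ))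
        = fun v => (((Real.sqrt (m v))⁻¹ : ℝ) : ℂ) := by
      ext v
      rw [← Complex.ofReal_mul]
      have := (Real.sqrt_pos.mpr (hm' v)).ne'
      congr 1
      field_simp
    rw [this]
    generalize (Matrix.diagonal (fun v => (((Real.sqrt (m v))⁻¹ : ℝ) : ℂ))).mulVec x = y
    have h := aux_nonneg (fun v u => w v u - w' v u) α
      (fun v u => by rw [hw_symm v u, hw'_symm v u])
      (fun v u => sub_nonneg.mpr (hww' v u)) hα y
    rw [aux_form] at h ⊢
    rw [aux_form]
    simp only [sub_mul, Finset.sum_sub_distrib] at h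
    linarith
  · intro x
    refine Finset.sum_le_sum fun v _ => ?_
    rw [Matrix.mulVec_diagonal, Complex.normSq_mul, Complex.normSq_ofReal]
    have h1 : 1 ≤ Real.sqrt (m' v) / Real.sqrt (m v) := by
      rw [one_le_div (Real.sqrt_pos.mpr (hm v))]
      exact Real.sqrt_le_sqrt (hmm' v)
    nlinarith [Complex.normSq_nonneg (x v), mul_le_mul h1 h1 zero_le_one (by linarith)]
end

section
/- Let V be a nonempty finite type with n = |V| ≥ 2, α : V → V → ℝ antisymmetric, and let x ≠ y in V. Let (w, m) and (w', m') be weights on V such that: w' x y = w' y x = 0; w' v u ≤ w v u for all pairs {v,u} ≠ {x,y}; m v ≤ m' v for all v ∉ {x, y}; m x − w x y ≤ m' x and m y − w x y ≤ m' y; and the relative weight satisfies (Σ_u w v u)/(m v) ≤ 1 for every v ∈ V. Then λ_k(w', m', α) ≤ λ_{k+1}(w, m, α) for all 1 ≤ k ≤ n − 1. -/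
open Matrix in
lemma lamk_herm {V : Type} [Fintype V] [DecidableEq V] (H : Matrix V V ℂ) (hH : H.IsHermitian)
    (j : Fin (Fintype.card V)) : lamk H j = hH.eigenvalues₀ j.rev := by
  have h : (H.charpoly.roots.map Complex.re).sort (· ≤ ·)
      = List.ofFn (fun j : Fin (Fintype.card V) => hH.eigenvalues₀ j.rev) := by
    have h1 : H.charpoly.roots.map Complex.re =
        ((List.ofFn (fun j : Fin (Fintype.card V) => hH.eigenvalues₀ j.rev) : List ℝ) :
          Multiset ℝ) := by
      rw [hH.roots_charpoly_eq_eigenvalues₀, Multiset.map_map, ← Fin.univ_val_map]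
      have h2 : (Complex.re ∘ (RCLike.ofReal ∘ hH.eigenvalues₀ : _ → ℂ)) = hH.eigenvalues₀ := by
        funext i; simp
      rw [h2]
      have h3 : (Finset.univ : Finset (Fin (Fintype.card V))).val.map Fin.rev = Finset.univ.val := by
        have := congrArg Finset.val (Finset.map_univ_equiv (Fin.revPerm (n := Fintype.card V)))
        rw [Finset.map_val] at this
        exact this
      conv_lhs => rw [← h3, Multiset.map_map]
      rfl
    rw [h1, Multiset.coe_sort]
    apply List.mergeSort_of_pairwise
    simp_rw [decide_eq_true_eq, ← List.sortedLE_iff_pairwise]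
    apply Monotone.sortedLE_ofFn
    intro a b hab
    exact hH.eigenvalues₀_antitone (Fin.rev_le_rev.mpr hab)
  unfold lamk
  rw [h, List.getD_eq_getElem _ _ (by simp)]
  simp

open Matrix in
lemma herm_diag {V : Type} [Fintype V] [DecidableEq V] (H : Matrix V V ℂ) (hH : H.IsHermitian) :
    ∃ b : OrthonormalBasis (Fin (Fintype.card V)) ℂ (EuclideanSpace ℂ V),
      (∀ j : Fin (Fintype.card V), H *ᵥ ⇑(b j) = (lamk H j : ℝ) • ⇑(b j)) ∧
      ∀ i j : Fin (Fintype.card V), i ≤ j → lamk H i ≤ lamk H j := by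
  let e : Fin (Fintype.card V) ≃ V :=
    Fin.revPerm.trans (Fintype.equivOfCardEq (Fintype.card_fin _))
  refine ⟨hH.eigenvectorBasis.reindex e.symm, fun j => ?_, fun i j hij => ?_⟩
  · rw [OrthonormalBasis.reindex_apply, hH.mulVec_eigenvectorBasis, lamk_herm H hH]
    simp [IsHermitian.eigenvalues, e]
  · rw [lamk_herm H hH, lamk_herm H hH]
    exact hH.eigenvalues₀_antitone (Fin.rev_le_rev.mpr hij)

open Matrix in
lemma herm_quad {V : Type} [Fintype V] [DecidableEq V] (H : Matrix V V ℂ) (hH : H.IsHermitian)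
    (b : OrthonormalBasis (Fin (Fintype.card V)) ℂ (EuclideanSpace ℂ V)) (l : Fin (Fintype.card V) → ℝ)
    (hb : ∀ j, H *ᵥ ⇑(b j) = (l j) • ⇑(b j)) (ψ : EuclideanSpace ℂ V) :
    (star (⇑ψ) ⬝ᵥ (H *ᵥ ⇑ψ)).re = ∑ j, l j * ‖b.repr ψ j‖ ^ 2 := by
  have h1 := b.sum_inner_mul_inner ψ (WithLp.toLp 2 (H *ᵥ ⇑ψ))
  have h2 : ∀ j, inner ℂ (b j) (WithLp.toLp 2 (H *ᵥ ⇑ψ)) = (l j : ℂ) * inner ℂ (b j) ψ := by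
    intro j
    rw [EuclideanSpace.inner_eq_star_dotProduct, EuclideanSpace.inner_eq_star_dotProduct]
    have : (H *ᵥ ⇑ψ) ⬝ᵥ star ⇑(b j) = ⇑ψ ⬝ᵥ star (H *ᵥ ⇑(b j)) := by
      rw [star_mulVec, hH.eq, dotProduct_comm, dotProduct_mulVec, dotProduct_comm]
    simp only [this, hb]
    simp
  have h3 : inner ℂ ψ (WithLp.toLp 2 (H *ᵥ ⇑ψ)) = star (⇑ψ) ⬝ᵥ (H *ᵥ ⇑ψ) := by
    rw [EuclideanSpace.inner_eq_star_dotProduct, dotProduct_comm]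
  rw [← h3, ← h1, Complex.re_sum]
  refine Finset.sum_congr rfl fun j _ => ?_
  rw [h2, b.repr_apply_apply, ← inner_conj_symm ψ (b j), mul_left_comm,
    ← Complex.normSq_eq_conj_mul_self, Complex.normSq_eq_norm_sq, ← Complex.ofReal_mul,
    Complex.ofReal_re]

noncomputable def qf {V : Type} [Fintype V] (w : V → V → ℝ) (α : V → V → ℝ) (φ : V → ℂ) : ℝ :=
  1 / 2 * ∑ v, ∑ u, w v u * ‖φ v - Complex.exp (Complex.I * (α v u : ℝ)) * φ u‖ ^ 2

lemma norm_eI (t : ℝ) : ‖Complex.exp (Complex.I * (t : ℝ))‖ = 1 := by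
  rw [mul_comm]; exact Complex.norm_exp_ofReal_mul_I t

lemma norm_sub_eI (a b : ℂ) (t : ℝ) :
    ‖a - Complex.exp (Complex.I * (t : ℝ)) * b‖ ^ 2 =
      ‖a‖ ^ 2 + ‖b‖ ^ 2 - 2 * (star a * (Complex.exp (Complex.I * (t : ℝ)) * b)).re := by
  have h : ‖b‖ ^ 2 = ‖Complex.exp (Complex.I * (t : ℝ)) * b‖ ^ 2 := by
    rw [norm_mul, norm_eI, one_mul]
  rw [h]
  generalize Complex.exp (Complex.I * (t : ℝ)) * b = c
  simp only [← Complex.normSq_eq_norm_sq, Complex.normSq_apply]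
  simp
  ring

lemma star_eI (t : ℝ) : star (Complex.exp (Complex.I * (t : ℝ))) =
    Complex.exp (Complex.I * ((-t : ℝ) : ℂ)) := by
  change (starRingEnd ℂ) _ = _
  rw [← Complex.exp_conj]
  simp

open Matrix in
lemma mag_diag {V : Type} [Fintype V] [DecidableEq V]
    (w : V → V → ℝ) (m : V → ℝ) (α : V → V → ℝ)
    (hw : ∀ v u, w v u = w u v) (hm : ∀ v, 0 < m v) (hα : ∀ v u, α v u = - α u v) :
    (∃ F : (V → ℂ) ≃ₗ[ℂ] (Fin (Fintype.card V) → ℂ),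
      (∀ φ, ∑ v, m v * ‖φ v‖ ^ 2 = ∑ j, ‖F φ j‖ ^ 2) ∧
      (∀ φ, qf w α φ = ∑ j : Fin (Fintype.card V), lamk (magLap w m α) j * ‖F φ j‖ ^ 2)) ∧
    ∀ i j : Fin (Fintype.card V), i ≤ j → lamk (magLap w m α) i ≤ lamk (magLap w m α) j := by
  set A := magLap w m α with hA
  let s : V → ℂ := fun v => (Real.sqrt (m v) : ℂ)
  have hs : ∀ v, s v ≠ 0 := fun v => by
    simp only [s]; exact_mod_cast (Real.sqrt_pos.mpr (hm v)).ne'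
  have hss : ∀ v, s v * s v = (m v : ℂ) := fun v => by
    simp only [s]; exact_mod_cast Real.mul_self_sqrt (hm v).le
  have hsc : ∀ v, star (s v) = s v := fun v => Complex.conj_ofReal _
  let H : Matrix V V ℂ := diagonal s * A * diagonal (fun v => (s v)⁻¹)
  have hHa : ∀ v u, H v u = s v * A v u * (s u)⁻¹ := fun v u => by
    simp [H, mul_diagonal, diagonal_mul]
  have hmA : ∀ v u, (m v : ℂ) * A v u =
      (if v = u then ((∑ u', w v u' : ℝ) : ℂ) else 0)
        - (w v u : ℂ) * Complex.exp (Complex.I * (α v u : ℝ)) := fun v u => by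
    have : (m v : ℂ) ≠ 0 := by exact_mod_cast (hm v).ne'
    simp only [hA, magLap]
    split_ifs
    · push_cast; field_simp
    · push_cast; field_simp; ring
  have hmAs : ∀ v u, star ((m u : ℂ) * A u v) = (m v : ℂ) * A v u := fun v u => by
    rw [hmA, hmA, star_sub, star_mul', star_eI, hα u v, neg_neg, hw u v]
    congr 1
    · by_cases h : v = u
      · subst h; simp
      · rw [if_neg h, if_neg (Ne.symm h), star_zero]
    · congr 1; exact Complex.conj_ofReal _
  have hH : H.IsHermitian := by
    ext v u
    rw [conjTranspose_apply, hHa, hHa]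
    have h := hmAs v u
    rw [← hss, ← hss] at h
    simp only [star_mul', star_inv₀, hsc] at h ⊢
    have h1 := hs v
    have h2 := hs u
    field_simp
    linear_combination h
  have hchar : H.charpoly = A.charpoly := by
    simp only [H]
    rw [charpoly_mul_comm, ← mul_assoc, diagonal_mul_diagonal]
    simp [hs]
  have hlam : ∀ k, lamk A k = lamk H k := fun k => by simp [lamk, hchar]
  obtain ⟨b, hb, hmono⟩ := herm_diag H hH
  simp only [hlam]
  refine ⟨?_, hmono⟩
  let D : (V → ℂ) ≃ₗ[ℂ] (V → ℂ) :=
    LinearEquiv.piCongrRight (fun v => LinearEquiv.smulOfNeZero ℂ ℂ (s v) (hs v))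
  have hD : ∀ φ v, D φ v = s v * φ v := fun φ v => rfl
  let F : (V → ℂ) ≃ₗ[ℂ] (Fin (Fintype.card V) → ℂ) :=
    D.trans ((WithLp.linearEquiv 2 ℂ (V → ℂ)).symm.trans
      (b.repr.toLinearEquiv.trans (WithLp.linearEquiv 2 ℂ (Fin (Fintype.card V) → ℂ))))
  have hF : ∀ φ j, F φ j = b.repr (WithLp.toLp 2 (D φ)) j := fun φ j => rfl
  refine ⟨F, fun φ => ?_, fun φ => ?_⟩
  · simp only [hF]
    rw [← EuclideanSpace.norm_sq_eq, LinearIsometryEquiv.norm_map, EuclideanSpace.norm_sq_eq]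
    refine Finset.sum_congr rfl fun v _ => ?_
    simp only [hD, norm_mul, mul_pow, s, Complex.norm_real, Real.norm_eq_abs, sq_abs]
    rw [Real.sq_sqrt (hm v).le]
  · simp only [hF]
    rw [← herm_quad H hH b (fun j => lamk H j) hb]
    have h1 : star (D φ) ⬝ᵥ (H *ᵥ (D φ)) = ∑ v, ∑ u, star (φ v) * (((m v : ℂ) * A v u) * φ u) := by
      simp only [dotProduct, mulVec, Finset.mul_sum]
      refine Finset.sum_congr rfl fun v _ => Finset.sum_congr rfl fun u _ => ?_
      rw [Pi.star_apply, hD, hD, hHa, star_mul', hsc, ← hss]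
      have h2 := hs u
      field_simp
    change qf w α φ = (star (D φ) ⬝ᵥ (H *ᵥ (D φ))).re
    rw [h1]
    simp only [hmA, sub_mul, mul_sub, Finset.sum_sub_distrib, Complex.sub_re, ite_mul, mul_ite,
      zero_mul, mul_zero, Finset.sum_ite_eq, Finset.mem_univ, if_true, Complex.re_sum]
    have h3 : ∀ v, (star (φ v) * (((∑ u', w v u' : ℝ) : ℂ) * φ v)).re = ∑ u, w v u * ‖φ v‖ ^ 2 := by
      intro v
      rw [← Finset.sum_mul, mul_left_comm, ← Complex.normSq_eq_norm_sq, Complex.re_ofReal_mul]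
      congr 1
      simp [Complex.normSq_apply]
    have h4 : ∀ v u, (star (φ v) * ((w v u : ℂ) * Complex.exp (Complex.I * (α v u : ℝ)) * φ u)).re
        = w v u * (star (φ v) * (Complex.exp (Complex.I * (α v u : ℝ)) * φ u)).re := by
      intro v u
      rw [mul_assoc, mul_left_comm, Complex.re_ofReal_mul]
    simp only [h3, h4]
    unfold qf
    simp only [norm_sub_eI, mul_sub, mul_add, Finset.sum_sub_distrib, Finset.sum_add_distrib]
    have h5 : ∑ v, ∑ u, w v u * ‖φ u‖ ^ 2 = ∑ v, ∑ u, w v u * ‖φ v‖ ^ 2 := by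
      rw [Finset.sum_comm]
      refine Finset.sum_congr rfl fun v _ => Finset.sum_congr rfl fun u _ => ?_
      rw [hw]
    rw [h5]
    simp only [mul_left_comm _ (2 : ℝ), ← Finset.mul_sum]
    ring

lemma qf_nonneg {V : Type} [Fintype V] (w : V → V → ℝ) (α : V → V → ℝ) (φ : V → ℂ)
    (hw : ∀ v u, 0 ≤ w v u) : 0 ≤ qf w α φ := by
  unfold qf
  have : 0 ≤ ∑ v, ∑ u, w v u * ‖φ v - Complex.exp (Complex.I * (α v u : ℝ)) * φ u‖ ^ 2 :=
    Finset.sum_nonneg fun v _ => Finset.sum_nonneg fun u _ => mul_nonneg (hw v u) (sq_nonneg _)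
  linarith

lemma qf_le {V : Type} [Fintype V] (w : V → V → ℝ) (m : V → ℝ) (α : V → V → ℝ) (φ : V → ℂ)
    (hws : ∀ v u, w v u = w u v) (hw : ∀ v u, 0 ≤ w v u) (hm : ∀ v, 0 < m v)
    (hrho : ∀ v, (∑ u, w v u) / m v ≤ 1) : qf w α φ ≤ 2 * ∑ v, m v * ‖φ v‖ ^ 2 := by
  unfold qf
  have h1 : ∑ v, ∑ u, w v u * ‖φ v - Complex.exp (Complex.I * (α v u : ℝ)) * φ u‖ ^ 2
      ≤ ∑ v, ∑ u, (2 * (w v u * ‖φ v‖ ^ 2) + 2 * (w v u * ‖φ u‖ ^ 2)) := by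
    refine Finset.sum_le_sum fun v _ => Finset.sum_le_sum fun u _ => ?_
    have h2 : ‖φ v - Complex.exp (Complex.I * (α v u : ℝ)) * φ u‖ ≤ ‖φ v‖ + ‖φ u‖ := by
      refine (norm_sub_le _ _).trans ?_
      rw [norm_mul, norm_eI, one_mul]
    have h3 : ‖φ v - Complex.exp (Complex.I * (α v u : ℝ)) * φ u‖ ^ 2 ≤ (‖φ v‖ + ‖φ u‖) ^ 2 :=
      pow_le_pow_left₀ (norm_nonneg _) h2 2
    have h4 : ‖φ v - Complex.exp (Complex.I * (α v u : ℝ)) * φ u‖ ^ 2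
        ≤ 2 * ‖φ v‖ ^ 2 + 2 * ‖φ u‖ ^ 2 := by nlinarith [sq_nonneg (‖φ v‖ - ‖φ u‖)]
    nlinarith [mul_le_mul_of_nonneg_left h4 (hw v u)]
  have h5 : ∑ v, ∑ u, w v u * ‖φ u‖ ^ 2 = ∑ v, ∑ u, w v u * ‖φ v‖ ^ 2 := by
    rw [Finset.sum_comm]
    refine Finset.sum_congr rfl fun v _ => Finset.sum_congr rfl fun u _ => ?_
    rw [hws]
  have h6 : ∑ v, ∑ u, w v u * ‖φ v‖ ^ 2 ≤ ∑ v, m v * ‖φ v‖ ^ 2 := by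
    refine Finset.sum_le_sum fun v _ => ?_
    rw [← Finset.sum_mul]
    refine mul_le_mul_of_nonneg_right ?_ (sq_nonneg _)
    have := hrho v
    rwa [div_le_one (hm v)] at this
  simp only [Finset.sum_add_distrib, ← Finset.mul_sum] at h1
  rw [h5] at h1
  linarith

lemma qf_del {V : Type} [Fintype V] [DecidableEq V] (w w' : V → V → ℝ) (α : V → V → ℝ) (φ : V → ℂ)
    (x y : V) (hxy : x ≠ y)
    (hw_symm : ∀ v u, w v u = w u v)
    (hα : ∀ v u, α v u = - α u v)
    (hdel : w' x y = 0) (hdel' : w' y x = 0)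
    (hww' : ∀ v u, s(v, u) ≠ s(x, y) → w' v u ≤ w v u)
    (hφ : φ x + Complex.exp (Complex.I * (α x y : ℝ)) * φ y = 0) :
    qf w' α φ + w x y * (2 * (‖φ x‖ ^ 2 + ‖φ y‖ ^ 2)) ≤ qf w α φ := by
  set E : V → V → ℝ := fun v u => ‖φ v - Complex.exp (Complex.I * (α v u : ℝ)) * φ u‖ ^ 2 with hE
  have hnxy : ‖φ x‖ = ‖φ y‖ := by
    rw [eq_neg_of_add_eq_zero_left hφ, norm_neg, norm_mul, norm_eI, one_mul]
  have h1 : E x y = 2 * (‖φ x‖ ^ 2 + ‖φ y‖ ^ 2) := by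
    have : φ x - Complex.exp (Complex.I * (α x y : ℝ)) * φ y = 2 * φ x := by
      linear_combination -hφ
    simp only [hE, this, norm_mul, ← hnxy]
    norm_num
    ring
  have h2 : E y x = 2 * (‖φ x‖ ^ 2 + ‖φ y‖ ^ 2) := by
    have h3 : Complex.exp (Complex.I * (α y x : ℝ)) * Complex.exp (Complex.I * (α x y : ℝ)) = 1 := by
      rw [← Complex.exp_add, hα y x]; simp
    have : φ y - Complex.exp (Complex.I * (α y x : ℝ)) * φ x = 2 * φ y := by
      linear_combination (-Complex.exp (Complex.I * (α y x : ℝ))) * hφ + φ y * h3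
    simp only [hE, this, norm_mul, hnxy]
    norm_num
    ring
  have key : ∑ v, ∑ u, w' v u * E v u + 2 * (w x y * (2 * (‖φ x‖ ^ 2 + ‖φ y‖ ^ 2)))
      ≤ ∑ v, ∑ u, w v u * E v u := by
    have h4 : ∀ v u, w' v u * E v u + ((if v = x then (if u = y then w x y * E x y else 0) else 0)
        + (if v = y then (if u = x then w x y * E y x else 0) else 0)) ≤ w v u * E v u := by
      intro v u
      by_cases ha : v = x ∧ u = y
      · obtain ⟨rfl, rfl⟩ := ha
        simp [hxy, hdel]
      by_cases hb : v = y ∧ u = x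
      · obtain ⟨rfl, rfl⟩ := hb
        simp [Ne.symm hxy, hdel', hw_symm v u]
      have hne : s(v, u) ≠ s(x, y) := by
        rw [Ne, Sym2.eq_iff]; tauto
      have h5 : (if v = x then (if u = y then w x y * E x y else 0) else 0) = 0 := by
        split_ifs <;> first | rfl | tauto
      have h6 : (if v = y then (if u = x then w x y * E y x else 0) else 0) = 0 := by
        split_ifs <;> first | rfl | tauto
      rw [h5, h6, add_zero, add_zero]
      exact mul_le_mul_of_nonneg_right (hww' v u hne) (sq_nonneg _)
    have h7 := Finset.sum_le_sum fun v (_ : v ∈ Finset.univ) =>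
      Finset.sum_le_sum fun u (_ : u ∈ Finset.univ) => h4 v u
    simp only [Finset.sum_add_distrib] at h7
    have h8 : ∑ v, ∑ u, (if v = x then (if u = y then w x y * E x y else 0) else 0)
        = w x y * E x y := by
      rw [Finset.sum_eq_single x] <;> simp +contextual
    have h9 : ∑ v, ∑ u, (if v = y then (if u = x then w x y * E y x else 0) else 0)
        = w x y * E y x := by
      rw [Finset.sum_eq_single y] <;> simp +contextual
    rw [h8, h9, h1, h2] at h7
    linarith
  unfold qf
  simp only [hE] at key
  linarith

lemma norm_del {V : Type} [Fintype V] [DecidableEq V] (c : ℝ) (m m' : V → ℝ) (φ : V → ℂ)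
    (x y : V) (hxy : x ≠ y)
    (hmm' : ∀ v, v ≠ x → v ≠ y → m v ≤ m' v)
    (hmx : m x - c ≤ m' x) (hmy : m y - c ≤ m' y) :
    ∑ v, m v * ‖φ v‖ ^ 2 ≤ ∑ v, m' v * ‖φ v‖ ^ 2 + c * (‖φ x‖ ^ 2 + ‖φ y‖ ^ 2) := by
  have h4 : ∀ v, m v * ‖φ v‖ ^ 2 ≤ m' v * ‖φ v‖ ^ 2 + ((if v = x then c * ‖φ x‖ ^ 2 else 0)
        + (if v = y then c * ‖φ y‖ ^ 2 else 0)) := by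
    intro v
    by_cases ha : v = x
    · subst ha
      simp only [if_true, if_neg hxy]
      nlinarith [mul_le_mul_of_nonneg_right hmx (sq_nonneg ‖φ v‖)]
    by_cases hb : v = y
    · subst hb
      simp only [if_true, if_neg ha]
      nlinarith [mul_le_mul_of_nonneg_right hmy (sq_nonneg ‖φ v‖)]
    simp only [if_neg ha, if_neg hb, add_zero]
    exact mul_le_mul_of_nonneg_right (hmm' v ha hb) (sq_nonneg _)
  have h7 := Finset.sum_le_sum fun v (_ : v ∈ Finset.univ) => h4 v
  simp only [Finset.sum_add_distrib, Finset.sum_ite_eq', Finset.mem_univ, if_true] at h7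
  linarith

/-- edge deletion with interior vertex weight loss `w x y` and
maximal relative weight `ρ_∞ ≤ 1`: the eigenvalues of the perturbed Laplacian
interlace from below with shift one, `λ'_k ≤ λ_{k+1}`. -/
theorem stmt9 {V : Type} [Fintype V] [DecidableEq V] [Nonempty V]
    (hn : 2 ≤ Fintype.card V)
    (w w' : V → V → ℝ) (m m' : V → ℝ) (α : V → V → ℝ)
    (x y : V) (hxy : x ≠ y)
    (hw_symm : ∀ v u, w v u = w u v) (hw_nonneg : ∀ v u, 0 ≤ w v u)
    (hw_diag : ∀ v, w v v = 0)
    (hw'_symm : ∀ v u, w' v u = w' u v) (hw'_nonneg : ∀ v u, 0 ≤ w' v u)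
    (hw'_diag : ∀ v, w' v v = 0)
    (hm : ∀ v, 0 < m v) (hm' : ∀ v, 0 < m' v)
    (hα : ∀ v u, α v u = - α u v)
    (hdel : w' x y = 0) (hdel' : w' y x = 0)
    (hww' : ∀ v u, s(v, u) ≠ s(x, y) → w' v u ≤ w v u)
    (hmm' : ∀ v, v ≠ x → v ≠ y → m v ≤ m' v)
    (hmx : m x - w x y ≤ m' x) (hmy : m y - w x y ≤ m' y)
    (hrho : ∀ v, (∑ u, w v u) / m v ≤ 1) :
    ∀ k : ℕ, 1 ≤ k → k ≤ Fintype.card V - 1 →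
      lamk (magLap w' m' α) (k - 1) ≤ lamk (magLap w m α) k := by
  intro k hk1 hk2
  obtain ⟨⟨F, hFn, hFq⟩, hmono⟩ := mag_diag w m α hw_symm hm hα
  obtain ⟨⟨F', hFn', hFq'⟩, hmono'⟩ := mag_diag w' m' α hw'_symm hm' hα
  set L := lamk (magLap w m α) with hL
  set L' := lamk (magLap w' m' α) with hL'
  have hkn : k < (Fintype.card V) := by omega
  -- bounds on the eigenvalue
  have hbd : 0 ≤ L k ∧ L k ≤ 2 := by
    let φ := F.symm (Pi.single ⟨k, hkn⟩ 1)
    have h1 : ∑ v, m v * ‖φ v‖ ^ 2 = 1 := by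
      rw [hFn, Finset.sum_eq_single ⟨k, hkn⟩] <;> simp +contextual [φ]
    have h2 : qf w α φ = L k := by
      rw [hFq, Finset.sum_eq_single ⟨k, hkn⟩] <;> simp +contextual [φ]
    have h3 := qf_nonneg w α φ hw_nonneg
    have h4 := qf_le w m α φ hw_symm hw_nonneg hm hrho
    constructor <;> linarith
  -- the test function
  let G : (V → ℂ) →ₗ[ℂ] ((Fin ((Fintype.card V) - k - 1) → ℂ) × ℂ × (Fin (k - 1) → ℂ)) :=
    LinearMap.prod
      (LinearMap.pi fun j : Fin ((Fintype.card V) - k - 1) =>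
        (LinearMap.proj (⟨k + 1 + j, by omega⟩ : Fin (Fintype.card V))) ∘ₗ F.toLinearMap)
      (LinearMap.prod
        (LinearMap.proj (R := ℂ) (φ := fun _ : V => ℂ) x
          + Complex.exp (Complex.I * (α x y : ℝ)) • LinearMap.proj (R := ℂ) (φ := fun _ : V => ℂ) y)
        (LinearMap.pi fun j : Fin (k - 1) =>
          (LinearMap.proj (⟨j, by omega⟩ : Fin (Fintype.card V))) ∘ₗ F'.toLinearMap))
  have hker : LinearMap.ker G ≠ ⊥ := by
    apply LinearMap.ker_ne_bot_of_finrank_lt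
    simp only [Module.finrank_prod, Module.finrank_self,
      Module.finrank_fintype_fun_eq_card, Fintype.card_fin]
    omega
  obtain ⟨φ, hφG, hφ0⟩ := (Submodule.ne_bot_iff _).mp hker
  rw [LinearMap.mem_ker] at hφG
  have hG1 : ∀ j : Fin (Fintype.card V), k < j.val → F φ j = 0 := by
    intro j hj
    have := congrFun (congrArg Prod.fst hφG) ⟨j.val - (k + 1), by omega⟩
    have h2 : (⟨k + 1 + (j.val - (k + 1)), by omega⟩ : Fin (Fintype.card V)) = j := by
      ext; simp; omega
    change F φ ⟨k + 1 + (j.val - (k + 1)), _⟩ = 0 at this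
    rwa [h2] at this
  have hG2 : φ x + Complex.exp (Complex.I * (α x y : ℝ)) * φ y = 0 :=
    congrArg (fun p => p.2.1) hφG
  have hG3 : ∀ j : Fin (Fintype.card V), j.val < k - 1 → F' φ j = 0 := by
    intro j hj
    exact congrFun (congrArg (fun p => p.2.2) hφG) ⟨j.val, hj⟩
  have hN : 0 < ∑ v, m' v * ‖φ v‖ ^ 2 := by
    obtain ⟨v, hv⟩ := Function.ne_iff.mp hφ0
    refine Finset.sum_pos' (fun u _ => mul_nonneg (hm' u).le (sq_nonneg _)) ⟨v, Finset.mem_univ _, ?_⟩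
    have : 0 < ‖φ v‖ := norm_pos_iff.mpr hv
    have := hm' v
    positivity
  have hup : qf w α φ ≤ L k * ∑ v, m v * ‖φ v‖ ^ 2 := by
    rw [hFn, hFq, Finset.mul_sum]
    refine Finset.sum_le_sum fun j _ => ?_
    by_cases hj : k < j.val
    · simp [hG1 j hj]
    · exact mul_le_mul_of_nonneg_right (hmono j ⟨k, hkn⟩ (by simpa [Fin.le_def] using hj)) (sq_nonneg _)
  have hlo : L' (k - 1) * ∑ v, m' v * ‖φ v‖ ^ 2 ≤ qf w' α φ := by
    rw [hFn', hFq', Finset.mul_sum]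
    refine Finset.sum_le_sum fun j _ => ?_
    by_cases hj : j.val < k - 1
    · simp [hG3 j hj]
    · exact mul_le_mul_of_nonneg_right
        (hmono' ⟨k - 1, by omega⟩ j (by rw [Fin.le_def]; exact not_lt.mp hj)) (sq_nonneg _)
  have hq := qf_del w w' α φ x y hxy hw_symm hα hdel hdel' hww' hG2
  have hnn := norm_del (w x y) m m' φ x y hxy hmm' hmx hmy
  have hS : 0 ≤ w x y * (‖φ x‖ ^ 2 + ‖φ y‖ ^ 2) := mul_nonneg (hw_nonneg x y) (by positivity)
  have h1 := mul_le_mul_of_nonneg_left hnn hbd.1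
  have h2 := mul_le_mul_of_nonneg_right hbd.2 hS
  refine le_of_mul_le_mul_right ?_ hN
  linarith
end

section
/- Let G be a finite simple graph on a vertex set V with n = |V| ≥ 2, let e₀ = {x,y} be an edge of G, let G' = G − e₀, and assume every vertex of G' has degree at least 1. Let α : V → V → ℝ be antisymmetric. For the magnetic standard Laplacians (vertex weight equal to the degree in the respective graph, edge weight the adjacency indicator) with the same α: λ_k(G, α) ≤ λ_{k+1}(G', α) and λ_k(G', α) ≤ λ_{k+1}(G, α) for all 1 ≤ k ≤ n − 1. -/
open scoped Classical

/-- The magnetic standard Laplacian of a simple graph: vertex weight the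
degree, edge weight the adjacency indicator. -/
noncomputable def stdLap {V : Type} [Fintype V] [DecidableEq V]
    (G : SimpleGraph V) (α : V → V → ℝ) : Matrix V V ℂ :=
  magLap (fun v u => if G.Adj v u then 1 else 0) (fun v => (G.degree v : ℝ)) α

open Matrix in
lemma aux_herm_s12 {V : Type} [Fintype V] [DecidableEq V] (H : Matrix V V ℂ) (hH : H.IsHermitian) :
    ∃ (C : (V → ℂ) →ₗ[ℂ] (Fin (Fintype.card V) → ℂ)) (l : Fin (Fintype.card V) → ℝ),
      Monotone l ∧ (∀ k, l k = lamk H k) ∧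
      (∀ ψ, (star ψ ⬝ᵥ (H *ᵥ ψ)).re = ∑ i, l i * Complex.normSq (C ψ i)) ∧
      (∀ ψ, (star ψ ⬝ᵥ ψ).re = ∑ i, Complex.normSq (C ψ i)) := by
  let e : Fin (Fintype.card V) ≃ V := Fintype.equivOfCardEq (Fintype.card_fin _)
  let σ : Fin (Fintype.card V) ≃ V := Fin.revPerm.trans e
  let U : Matrix V V ℂ := hH.eigenvectorUnitary
  have hU1 : star U * U = 1 := Unitary.coe_star_mul_self hH.eigenvectorUnitary
  have hU2 : U * star U = 1 := Unitary.coe_mul_star_self hH.eigenvectorUnitary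
  have hsp : H = U * diagonal (RCLike.ofReal ∘ hH.eigenvalues) * star U := by
    have := hH.spectral_theorem
    rwa [Unitary.conjStarAlgAut_apply] at this
  let l : Fin (Fintype.card V) → ℝ := fun i => hH.eigenvalues₀ (Fin.rev i)
  have hl : ∀ i, l i = hH.eigenvalues (σ i) := by
    intro i
    simp [l, σ, e, Matrix.IsHermitian.eigenvalues]
  have hmono : Monotone l := by
    intro i j hij
    exact hH.eigenvalues₀_antitone (Fin.rev_le_rev.mpr hij)
  refine ⟨(LinearMap.funLeft ℂ ℂ σ).comp (Matrix.mulVecLin (star U)), l, hmono, ?_, ?_, ?_⟩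
  · intro k
    have hs : ((H.charpoly.roots.map Complex.re).sort (· ≤ ·)) = List.ofFn l := by
      apply List.Perm.eq_of_pairwise' (r := (· ≤ ·))
      · exact Multiset.pairwise_sort _ _
      · exact (List.sortedLE_ofFn_iff.mpr hmono).pairwise
      · rw [← Multiset.coe_eq_coe, Multiset.sort_eq, hH.roots_charpoly_eq_eigenvalues]
        have : (List.ofFn l : Multiset ℝ) = Multiset.map l Finset.univ.val := by
          rw [Fin.univ_val_map]
        rw [this, Multiset.map_map]
        have h2 : (Finset.univ : Finset V).val = Multiset.map σ (Finset.univ.val) := by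
          have := Finset.map_univ_equiv σ
          rw [← this]; simp
        rw [h2, Multiset.map_map]
        apply Multiset.map_congr rfl
        intro i _
        simp [hl]
    unfold lamk
    rw [hs]
    simp [List.getD_eq_getElem]
  · intro ψ
    have h1 : star ψ ⬝ᵥ (H *ᵥ ψ) = star (star U *ᵥ ψ) ⬝ᵥ
        (diagonal (RCLike.ofReal ∘ hH.eigenvalues) *ᵥ (star U *ᵥ ψ)) := by
      rw [star_mulVec, star_eq_conjTranspose, conjTranspose_conjTranspose, ← dotProduct_mulVec, mulVec_mulVec, mulVec_mulVec]
      conv_lhs => rw [hsp]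
      rfl
    rw [h1, ← Equiv.sum_comp σ.symm]
    simp only [dotProduct, mulVec_diagonal, Complex.re_sum, hl]
    apply Finset.sum_congr rfl
    intro i _
    simp [LinearMap.funLeft, Complex.normSq_apply]
    ring
  · intro ψ
    have h1 : star ψ ⬝ᵥ ψ = star (star U *ᵥ ψ) ⬝ᵥ (star U *ᵥ ψ) := by
      rw [star_mulVec, star_eq_conjTranspose, conjTranspose_conjTranspose, ← dotProduct_mulVec, mulVec_mulVec,
        ← star_eq_conjTranspose, hU2, one_mulVec]
    rw [h1, ← Equiv.sum_comp σ.symm]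
    simp only [dotProduct, Complex.re_sum]
    apply Finset.sum_congr rfl
    intro i _
    simp [LinearMap.funLeft, Complex.normSq_apply]

lemma aux_exists {V : Type} [Fintype V] [DecidableEq V] {n : ℕ} (hn : n = Fintype.card V)
    (C₁ C₂ : (V → ℂ) →ₗ[ℂ] (Fin n → ℂ)) (l₁ l₂ : Fin n → ℝ)
    (h₁ : Monotone l₁) (h₂ : Monotone l₂) (ℓ : (V → ℂ) →ₗ[ℂ] ℂ) (k : ℕ) (hk1 : 1 ≤ k)
    (hk : k < n) :
    ∃ φ : V → ℂ, φ ≠ 0 ∧ ℓ φ = 0 ∧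
      l₁ ⟨k - 1, by omega⟩ * ∑ i, Complex.normSq (C₁ φ i) ≤ ∑ i, l₁ i * Complex.normSq (C₁ φ i) ∧
      ∑ i, l₂ i * Complex.normSq (C₂ φ i) ≤ l₂ ⟨k, hk⟩ * ∑ i, Complex.normSq (C₂ φ i) := by
  let F : (V → ℂ) →ₗ[ℂ] (Fin (n - 1) → ℂ) := LinearMap.pi fun i =>
    if i.1 < k - 1 then (LinearMap.proj ⟨i.1, by omega⟩).comp C₁
    else if i.1 = k - 1 then ℓ
    else (LinearMap.proj ⟨i.1 + 1, by omega⟩).comp C₂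
  have hF : LinearMap.ker F ≠ ⊥ := by
    apply LinearMap.ker_ne_bot_of_finrank_lt
    simp
    omega
  obtain ⟨φ, hφ, hne⟩ := (Submodule.ne_bot_iff _).mp hF
  have hi : ∀ i, F φ i = 0 := fun i => congrFun (LinearMap.mem_ker.mp hφ) i
  refine ⟨φ, hne, ?_, ?_, ?_⟩
  · have := hi ⟨k - 1, by omega⟩
    simpa [F] using this
  · rw [Finset.mul_sum]
    apply Finset.sum_le_sum
    intro i _
    by_cases h : i.1 < k - 1
    · have := hi ⟨i.1, by omega⟩
      have h0 : C₁ φ i = 0 := by simpa [F, h] using this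
      simp [h0]
    · exact mul_le_mul_of_nonneg_right (h₁ (by rw [Fin.le_def]; simp; omega)) (Complex.normSq_nonneg _)
  · rw [Finset.mul_sum]
    apply Finset.sum_le_sum
    intro i _
    by_cases h : k < i.1
    · have := hi ⟨i.1 - 1, by omega⟩
      have e1 : ¬ (i.1 - 1 < k - 1) := by omega
      have e2 : ¬ (i.1 - 1 = k - 1) := by omega
      have e3 : i.1 - 1 + 1 = i.1 := by omega
      have h0 : C₂ φ i = 0 := by simpa [F, e1, e2, e3] using this
      simp [h0]
    · exact mul_le_mul_of_nonneg_right (h₂ (by rw [Fin.le_def]; simp; omega)) (Complex.normSq_nonneg _)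

/-- energy with sign `s` -/
noncomputable def enF {V : Type} [Fintype V] (w : V → V → ℝ) (α : V → V → ℝ) (s : ℂ)
    (φ : V → ℂ) : ℝ :=
  (∑ v, ∑ u, w v u * Complex.normSq (φ v - s * (Complex.exp (Complex.I * (α v u : ℝ)) * φ u))) / 2

noncomputable def nmF {V : Type} [Fintype V] (w : V → V → ℝ) (φ : V → ℂ) : ℝ :=
  ∑ v, (∑ u, w v u) * Complex.normSq (φ v)

lemma aux_pt (a b : ℂ) (t : ℝ) (s : ℝ) (hs : s * s = 1) :
    Complex.normSq (a - (s : ℂ) * (Complex.exp (Complex.I * (t : ℝ)) * b)) =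
      Complex.normSq a + Complex.normSq b
        - 2 * s * ((starRingEnd ℂ) a * Complex.exp (Complex.I * (t : ℝ)) * b).re := by
  have h1 : Complex.normSq ((s : ℂ) * (Complex.exp (Complex.I * (t : ℝ)) * b)) = Complex.normSq b := by
    rw [Complex.normSq_mul, Complex.normSq_mul, Complex.normSq_ofReal, hs]
    rw [Complex.normSq_eq_norm_sq (Complex.exp _), mul_comm Complex.I, Complex.norm_exp_ofReal_mul_I]
    simp
  rw [Complex.normSq_sub, h1]
  have : (a * (starRingEnd ℂ) ((s : ℂ) * (Complex.exp (Complex.I * (t : ℝ)) * b))).re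
     = s * ((starRingEnd ℂ) a * Complex.exp (Complex.I * (t : ℝ)) * b).re := by
    simp [Complex.mul_re, Complex.mul_im]
    ring
  rw [this]; ring

lemma aux_en {V : Type} [Fintype V] (w : V → V → ℝ) (hw : ∀ v u, w v u = w u v)
    (α : V → V → ℝ) (s : ℝ) (hs : s * s = 1) (φ : V → ℂ) :
    enF w α s φ = nmF w φ - s * ∑ v, ∑ u, w v u *
      ((starRingEnd ℂ) (φ v) * Complex.exp (Complex.I * (α v u : ℝ)) * φ u).re := by
  unfold enF nmF
  simp_rw [aux_pt _ _ _ s hs]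
  have h1 : ∑ v, ∑ u, w v u * Complex.normSq (φ u) = ∑ v, ∑ u, w v u * Complex.normSq (φ v) := by
    rw [Finset.sum_comm]
    simp_rw [hw]
  have : ∀ v u, w v u * (Complex.normSq (φ v) + Complex.normSq (φ u) - 2 * s *
      ((starRingEnd ℂ) (φ v) * Complex.exp (Complex.I * (α v u : ℝ)) * φ u).re)
      = w v u * Complex.normSq (φ v) + w v u * Complex.normSq (φ u) - 2 * s * (w v u *
      ((starRingEnd ℂ) (φ v) * Complex.exp (Complex.I * (α v u : ℝ)) * φ u).re) := by
    intros; ring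
  simp_rw [this, Finset.sum_sub_distrib, Finset.sum_add_distrib, h1, ← Finset.mul_sum, Finset.sum_mul]
  ring

lemma aux_en_two {V : Type} [Fintype V] (w : V → V → ℝ) (hw : ∀ v u, w v u = w u v)
    (hw0 : ∀ v u, 0 ≤ w v u) (α : V → V → ℝ) (φ : V → ℂ) :
    0 ≤ enF w α 1 φ ∧ enF w α 1 φ ≤ 2 * nmF w φ := by
  have h0 : ∀ s, 0 ≤ enF w α s φ := fun s => by
    unfold enF
    have : 0 ≤ ∑ v, ∑ u, w v u *
        Complex.normSq (φ v - s * (Complex.exp (Complex.I * (α v u : ℝ)) * φ u)) :=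
      Finset.sum_nonneg fun v _ => Finset.sum_nonneg fun u _ =>
        mul_nonneg (hw0 v u) (Complex.normSq_nonneg _)
    linarith
  refine ⟨h0 1, ?_⟩
  have h1 := aux_en w hw α 1 (by norm_num) φ
  have h2 := aux_en w hw α (-1) (by norm_num) φ
  have h3 := h0 ((-1 : ℝ) : ℂ)
  rw [Complex.ofReal_one] at h1
  linarith

lemma nm_pos {V : Type} [Fintype V] (w : V → V → ℝ) (hp : ∀ v, 0 < ∑ u, w v u)
    (φ : V → ℂ) (hφ : φ ≠ 0) : 0 < nmF w φ := by
  obtain ⟨v, hv⟩ := Function.ne_iff.mp hφ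
  apply Finset.sum_pos' (fun v _ => mul_nonneg (hp v).le (Complex.normSq_nonneg _))
  exact ⟨v, Finset.mem_univ _, mul_pos (hp v) (Complex.normSq_pos.mpr hv)⟩

open Matrix in
lemma aux_lap {V : Type} [Fintype V] [DecidableEq V] (w : V → V → ℝ) (hw : ∀ v u, w v u = w u v)
    (hp : ∀ v, 0 < ∑ u, w v u)
    (α : V → V → ℝ) (hα : ∀ v u, α v u = - α u v) :
    ∃ (C : (V → ℂ) →ₗ[ℂ] (Fin (Fintype.card V) → ℂ)) (l : Fin (Fintype.card V) → ℝ),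
      Monotone l ∧ (∀ k, l k = lamk (magLap w (fun v => ∑ u, w v u) α) k) ∧
      (∀ φ, enF w α 1 φ = ∑ i, l i * Complex.normSq (C φ i)) ∧
      (∀ φ, nmF w φ = ∑ i, Complex.normSq (C φ i)) := by
  let m : V → ℝ := fun v => ∑ u, w v u
  let r : V → ℂ := fun v => ((Real.sqrt (m v) : ℝ) : ℂ)
  have hr0 : ∀ v, r v ≠ 0 := fun v => by
    simp only [r, ne_eq, Complex.ofReal_eq_zero]
    exact (Real.sqrt_pos.mpr (hp v)).ne'
  have hrr : ∀ v, r v * r v = (m v : ℂ) := fun v => by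
    simp only [r]
    rw [← Complex.ofReal_mul, Real.mul_self_sqrt (hp v).le]
  have hrs : ∀ v, (starRingEnd ℂ) (r v) = r v := fun v => Complex.conj_ofReal _
  let A : Matrix V V ℂ := fun v u => (if v = u then (m v : ℂ) else 0)
    - (w v u : ℂ) * Complex.exp (Complex.I * (α v u : ℝ))
  let S : Matrix V V ℂ := diagonal (fun v => (r v)⁻¹)
  let H : Matrix V V ℂ := (S * A) * S
  have hL : magLap w m α = S * (S * A) := by
    ext v u
    rw [diagonal_mul, diagonal_mul]
    simp only [magLap, A]
    have h1 : ((m v : ℝ) : ℂ) = r v * r v := (hrr v).symm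
    have h2 := hr0 v
    by_cases h : v = u
    · simp only [h, if_true]
      push_cast
      have : (∑ x, (w u x : ℂ)) = (m u : ℂ) := by simp [m]
      rw [this, ← hrr u]
      have := hr0 u
      field_simp
    · simp only [h, if_false]
      push_cast
      rw [h1]
      field_simp
      ring
  have hchar : lamk (magLap w m α) = lamk H := by
    funext k
    unfold lamk
    rw [hL, charpoly_mul_comm]
  have hAH : A.IsHermitian := by
    ext v u
    rw [conjTranspose_apply]
    simp only [A, star_sub, star_mul']
    rw [hw u v]
    congr 1
    · by_cases h : v = u
      · subst h; simp
      · simp [h, Ne.symm h]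
    · congr 1
      · simp
      · rw [← starRingEnd_apply, ← Complex.exp_conj]
        simp [hα u v]
  have hH : H.IsHermitian := by
    have hS : Sᴴ = S := by
      simp only [S, diagonal_conjTranspose]
      congr 1
      funext v
      simp [r]
    unfold Matrix.IsHermitian
    simp only [H]
    rw [conjTranspose_mul, conjTranspose_mul, hS, hAH.eq, mul_assoc]
  obtain ⟨C, l, hm, hl, hq, hN⟩ := aux_herm_s12 H hH
  let T : Matrix V V ℂ := diagonal r
  refine ⟨C.comp (Matrix.mulVecLin T), l, hm, ?_, ?_, ?_⟩
  · intro k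
    rw [hl]; exact (congrFun hchar k).symm
  · intro φ
    have := hq (T *ᵥ φ)
    simp only [LinearMap.comp_apply, Matrix.mulVecLin_apply]
    rw [← this]
    have h1 := aux_en w hw α 1 (by norm_num) φ
    rw [Complex.ofReal_one] at h1
    rw [h1]
    simp only [H]
    have h3 : (S * A * S) *ᵥ (T *ᵥ φ) = S *ᵥ (A *ᵥ φ) := by
      have : S * T = 1 := by
        simp only [S, T, diagonal_mul_diagonal]
        rw [← diagonal_one]
        congr 1
        funext v
        exact inv_mul_cancel₀ (hr0 v)
      rw [mulVec_mulVec, mul_assoc, this, mul_one, mulVec_mulVec]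
    rw [h3]
    simp only [dotProduct, S, T, mulVec_diagonal, Complex.re_sum, nmF]
    rw [one_mul, ← Finset.sum_sub_distrib]
    apply Finset.sum_congr rfl
    intro v _
    have h4 : star (diagonal r *ᵥ φ) v * ((r v)⁻¹ * (A *ᵥ φ) v) = (starRingEnd ℂ) (φ v) * (A *ᵥ φ) v := by
      simp only [Pi.star_apply, mulVec_diagonal, star_mul']
      rw [← starRingEnd_apply, hrs]
      have := hr0 v
      simp only [← starRingEnd_apply]
      field_simp
    rw [h4]
    simp only [mulVec, dotProduct, A, sub_mul, Finset.sum_sub_distrib, mul_sub, Complex.sub_re]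
    congr 1
    · simp [m, Complex.normSq_apply]
      ring
    · rw [Finset.mul_sum, Complex.re_sum]
      apply Finset.sum_congr rfl
      intro u _
      rw [← Complex.re_ofReal_mul]
      congr 1
      ring
  · intro φ
    have := hN (T *ᵥ φ)
    simp only [LinearMap.comp_apply, Matrix.mulVecLin_apply]
    rw [← this]
    simp only [dotProduct, Complex.re_sum, nmF]
    apply Finset.sum_congr rfl
    intro v _
    have h4 : star (T *ᵥ φ) v * ((T *ᵥ φ) v) = (m v : ℂ) * (Complex.normSq (φ v) : ℂ) := by
      simp only [T, Pi.star_apply, mulVec_diagonal, star_mul']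
      rw [← starRingEnd_apply, hrs, ← hrr, Complex.normSq_eq_conj_mul_self, ← starRingEnd_apply]
      ring
    rw [h4, ← Complex.ofReal_mul, Complex.ofReal_re]

lemma aux_split {V : Type} [Fintype V] [DecidableEq V] (w w' : V → V → ℝ) (x y : V)
    (hxy : x ≠ y)
    (h : ∀ v u, w v u = w' v u + ((if v = x then (if u = y then 1 else 0) else 0)
      + (if v = y then (if u = x then 1 else 0) else 0)))
    (α : V → V → ℝ) (hα : ∀ v u, α v u = - α u v) (φ : V → ℂ) :
    enF w α 1 φ = enF w' α 1 φ +
      Complex.normSq (φ x - Complex.exp (Complex.I * (α x y : ℝ)) * φ y) ∧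
    nmF w φ = nmF w' φ + (Complex.normSq (φ x) + Complex.normSq (φ y)) := by
  constructor
  · have hsym : Complex.normSq (φ y - Complex.exp (Complex.I * (α y x : ℝ)) * φ x) =
        Complex.normSq (φ x - Complex.exp (Complex.I * (α x y : ℝ)) * φ y) := by
      have h1 : φ x - Complex.exp (Complex.I * (α x y : ℝ)) * φ y =
          (-Complex.exp (Complex.I * (α x y : ℝ))) *
            (φ y - Complex.exp (Complex.I * (α y x : ℝ)) * φ x) := by
        have : Complex.exp (Complex.I * (α x y : ℝ)) * Complex.exp (Complex.I * (α y x : ℝ)) = 1 := by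
          rw [← Complex.exp_add, hα y x]; simp
        linear_combination (-φ x) * this
      rw [h1, Complex.normSq_mul, Complex.normSq_neg, Complex.normSq_eq_norm_sq (Complex.exp _),
        mul_comm Complex.I (α x y : ℂ), Complex.norm_exp_ofReal_mul_I]
      simp
    unfold enF
    simp_rw [h, add_mul, Finset.sum_add_distrib]
    simp only [ite_mul, one_mul, zero_mul]
    have e1 : ∀ (a b : V) (f : V → V → ℝ),
        ∑ v, ∑ u, (if v = a then (if u = b then f v u else 0) else 0) = f a b := by
      intro a b f
      rw [Finset.sum_eq_single a]
      · simp
      · intro v _ hv; simp [hv]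
      · simp
    rw [e1, e1, hsym]
    ring
  · unfold nmF
    simp_rw [h, Finset.sum_add_distrib, add_mul, Finset.sum_add_distrib]
    simp

/-- deleting one edge from a graph with standard weights (no
isolated vertices after deletion): the eigenvalues interlace with shift one in
both directions, `λ_k(G) ≤ λ_{k+1}(G')` and `λ_k(G') ≤ λ_{k+1}(G)`. -/
theorem stmt12 {V : Type} [Fintype V] [DecidableEq V] [Nonempty V]
    (hn : 2 ≤ Fintype.card V)
    (G : SimpleGraph V) (x y : V) (hxy : G.Adj x y)
    (hdeg : ∀ v : V, 0 < (G.deleteEdges {s(x, y)}).degree v)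
    (α : V → V → ℝ) (hα : ∀ v u, α v u = - α u v) :
    ∀ k : ℕ, 1 ≤ k → k ≤ Fintype.card V - 1 →
      lamk (stdLap G α) (k - 1) ≤ lamk (stdLap (G.deleteEdges {s(x, y)}) α) k
      ∧ lamk (stdLap (G.deleteEdges {s(x, y)}) α) (k - 1) ≤ lamk (stdLap G α) k := by
  intro k hk1 hk
  have hkn : k < Fintype.card V := by omega
  set G' := G.deleteEdges {s(x, y)} with hG'
  let W : SimpleGraph V → V → V → ℝ := fun G v u => if G.Adj v u then 1 else 0
  have hWs : ∀ G v u, W G v u = W G u v := fun G v u => by simp only [W, G.adj_comm]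
  have hW0 : ∀ G v u, 0 ≤ W G v u := fun G v u => by simp only [W]; split_ifs <;> norm_num
  have hWd : ∀ G : SimpleGraph V, (fun v => ((G.degree v : ℕ) : ℝ)) = fun v => ∑ u, W G v u := by
    intro G; funext v
    simp [W, ← SimpleGraph.card_neighborFinset_eq_degree, SimpleGraph.neighborFinset_eq_filter]
  have hstd : ∀ G : SimpleGraph V, stdLap G α = magLap (W G) (fun v => ∑ u, W G v u) α := by
    intro G
    unfold stdLap
    rw [hWd]
  have hne : x ≠ y := hxy.ne
  have hsplit : ∀ v u, W G v u = W G' v u + ((if v = x then (if u = y then 1 else 0) else 0)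
      + (if v = y then (if u = x then 1 else 0) else 0)) := by
    intro v u
    have hyx := hxy.symm
    simp only [W, hG', SimpleGraph.deleteEdges_adj, Set.mem_singleton_iff, Sym2.eq_iff]
    by_cases h1 : v = x <;> by_cases h2 : u = y <;> by_cases h3 : v = y <;> by_cases h4 : u = x <;>
      simp_all
  have hp' : ∀ v, 0 < ∑ u, W G' v u := by
    intro v
    have := congrFun (hWd G') v
    rw [← this]
    have h2 := hdeg v
    rw [Nat.cast_pos]
    convert h2
  have hp : ∀ v, 0 < ∑ u, W G v u := by
    intro v
    refine lt_of_lt_of_le (hp' v) (Finset.sum_le_sum fun u _ => ?_)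
    rw [hsplit]
    have : (0:ℝ) ≤ ((if v = x then (if u = y then 1 else 0) else 0)
      + (if v = y then (if u = x then 1 else 0) else 0)) := by
      split_ifs <;> norm_num
    linarith
  rw [hstd, hstd]
  obtain ⟨C, l, hm, hl, hE, hN⟩ := aux_lap (W G) (hWs G) hp α hα
  obtain ⟨C', l', hm', hl', hE', hN'⟩ := aux_lap (W G') (hWs G') hp' α hα
  have hsp := aux_split (W G) (W G') x y hne hsplit α hα
  let c := Complex.exp (Complex.I * (α x y : ℝ))
  have hc : Complex.normSq c = 1 := by
    simp only [c]
    rw [Complex.normSq_eq_norm_sq, mul_comm Complex.I, Complex.norm_exp_ofReal_mul_I]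
    simp
  constructor
  · obtain ⟨φ, hφ, h0, hA, hB⟩ := aux_exists rfl C C' l l' hm hm'
      (LinearMap.proj x - c • LinearMap.proj y) k hk1 hkn
    rw [← hE, ← hN, hl] at hA
    rw [← hE', ← hN', hl'] at hB
    simp only at hA hB
    obtain ⟨s1, s2⟩ := hsp φ
    have h0' : φ x - c * φ y = 0 := by simpa using h0
    rw [show Complex.exp (Complex.I * (α x y : ℝ)) = c from rfl, h0', map_zero] at s1
    have hpos := nm_pos _ hp φ hφ
    have hpos' := nm_pos _ hp' φ hφ
    obtain ⟨q0, -⟩ := aux_en_two (W G') (hWs G') (hW0 G') α φ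
    have t1 := Complex.normSq_nonneg (φ x)
    have t2 := Complex.normSq_nonneg (φ y)
    have hl0 := nonneg_of_mul_nonneg_left (q0.trans hB) hpos'
    refine le_of_mul_le_mul_right ?_ hpos
    have := mul_nonneg hl0 (add_nonneg t1 t2)
    rw [s2] at hA ⊢
    linarith
  · obtain ⟨φ, hφ, h0, hA, hB⟩ := aux_exists rfl C' C l' l hm' hm
      (LinearMap.proj x + c • LinearMap.proj y) k hk1 hkn
    rw [← hE, ← hN, hl] at hB
    rw [← hE', ← hN', hl'] at hA
    simp only at hA hB
    obtain ⟨s1, s2⟩ := hsp φ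
    have h0' : φ x + c * φ y = 0 := by simpa using h0
    have hx : φ x = - (c * φ y) := by linear_combination h0'
    have n1 : Complex.normSq (φ x) = Complex.normSq (φ y) := by
      rw [hx, Complex.normSq_neg, Complex.normSq_mul, hc, one_mul]
    have n2 : Complex.normSq (φ x - c * φ y) = 4 * Complex.normSq (φ y) := by
      have : φ x - c * φ y = (-2 : ℂ) * (c * φ y) := by rw [hx]; ring
      rw [this, Complex.normSq_mul, Complex.normSq_mul, hc]
      simp [Complex.normSq_apply]; norm_num
    rw [show Complex.exp (Complex.I * (α x y : ℝ)) = c from rfl, n2] at s1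
    rw [n1] at s2
    have hpos := nm_pos _ hp φ hφ
    have hpos' := nm_pos _ hp' φ hφ
    obtain ⟨-, q2⟩ := aux_en_two (W G') (hWs G') (hW0 G') α φ
    have t2 := Complex.normSq_nonneg (φ y)
    have hl2 := le_of_mul_le_mul_right (hA.trans q2) hpos'
    refine le_of_mul_le_mul_right ?_ hpos
    have := mul_le_mul_of_nonneg_right hl2 t2
    rw [s2] at hB ⊢
    linarith
end
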